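/- Let κ ∈ ℝ and let μ be a finite complex Borel measure on ℝ³ whose support is contained in a compact set K ⊂ ℝ³. Define the Helmholtz single layer potential u(x) = ∫ exp(iκ‖x−y‖)/(4π‖x−y‖) dμ(y) for x ∈ ℝ³ \ K. Then u is well defined, infinitely differentiable on the open set ℝ³ \ K, and satisfies the Helmholtz equation there: Δu(x) + κ²u(x) = 0 for every x ∉ K. -/

import Mathlib

open MeasureTheory

/-- The Laplacian of a function `f : ℝ³ → ℂ` at a point `x`, i.e.
`∑_{k=1}^{3} ∂² f / ∂ x_k²` evaluated via iterated (Fréchet) derivatives in the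
coordinate directions. -/
noncomputable def laplacianC (f : EuclideanSpace ℝ (Fin 3) → ℂ)
    (x : EuclideanSpace ℝ (Fin 3)) : ℂ :=
  ∑ k : Fin 3,
    fderiv ℝ (fun z => fderiv ℝ f z (EuclideanSpace.single k (1 : ℝ))) x
      (EuclideanSpace.single k (1 : ℝ))

/-- The Helmholtz fundamental solution with wavenumber `κ`,
`u*(x, y) = exp(iκ‖x - y‖)/(4π‖x - y‖)`. -/
noncomputable def helmholtzKernel (κ : ℝ) (x y : EuclideanSpace ℝ (Fin 3)) : ℂ :=
  Complex.exp (Complex.I * κ * ‖x - y‖) / (4 * Real.pi * ‖x - y‖ : ℝ)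

open scoped ContDiff Topology
open Filter

section Potential

lemma ae_mem_of_measure_compl_eq_zero {E : Type*} [MeasurableSpace E] {μ : Measure E} {K : Set E}
    (hsupp : μ Kᶜ = 0) : ∀ᵐ y ∂μ, y ∈ K :=
  (measure_eq_zero_iff_ae_notMem.1 hsupp).mono fun _ h => not_not.1 h

lemma sub_mem_compl_zero {E : Type*} [AddGroup E] {K : Set E} {x y : E} (hx : x ∉ K)
    (hy : y ∈ K) : x - y ∈ ({0}ᶜ : Set E) :=
  fun h => hx (sub_eq_zero.1 h ▸ hy)

/-- A kernel continuous off the origin is bounded, uniformly for `x` in some neighbourhood of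
a point outside the compact set `K` and `y ∈ K`. -/
lemma exists_nhds_bound_comp_sub {E F : Type*} [NormedAddCommGroup E] [ProperSpace E]
    [NormedAddCommGroup F] {K : Set E} (hK : IsCompact K) {g : E → F}
    (hg : ContinuousOn g {0}ᶜ) {x : E} (hx : x ∉ K) :
    ∃ s ∈ 𝓝 x, s ⊆ Kᶜ ∧ ∃ C, ∀ z ∈ s, ∀ y ∈ K, ‖g (z - y)‖ ≤ C := by
  obtain ⟨s, hs, hsK, hsc⟩ :=
    local_compact_nhds (hK.isClosed.isOpen_compl.mem_nhds (show x ∈ Kᶜ from hx))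
  have hc : ContinuousOn (fun p : E × E => g (p.1 - p.2)) (s ×ˢ K) :=
    hg.comp (by fun_prop) fun p hp => sub_mem_compl_zero (hsK hp.1) hp.2
  obtain ⟨C, hC⟩ := (hsc.prod hK).exists_bound_of_continuousOn hc
  exact ⟨s, hs, hsK, C, fun z hz y hy => hC (z, y) ⟨hz, hy⟩⟩

variable {E F : Type} [NormedAddCommGroup E] [MeasurableSpace E] [NormedAddCommGroup F]

/-- The convolution-type potential of the density `w dμ` with kernel `g`. -/
noncomputable def convPotential [NormedSpace ℝ F] [NormedSpace ℂ F] (μ : Measure E) (w : E → ℂ)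
    (g : E → F) (x : E) : F :=
  ∫ y, w y • g (x - y) ∂μ

variable [BorelSpace E] [SecondCountableTopology E] {μ : Measure E} {w : E → ℂ} {K : Set E}

lemma aestronglyMeasurable_comp_sub (hK : IsCompact K) (hsupp : μ Kᶜ = 0) {g : E → F}
    (hg : ContinuousOn g {0}ᶜ) {x : E} (hx : x ∉ K) :
    AEStronglyMeasurable (fun y => g (x - y)) μ := by
  have h : ContinuousOn (fun y => g (x - y)) K :=
    hg.comp (by fun_prop) fun y hy => sub_mem_compl_zero hx hy
  have := h.aestronglyMeasurable (μ := μ) hK.measurableSet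
  rwa [Measure.restrict_eq_self_of_ae_mem (ae_mem_of_measure_compl_eq_zero hsupp)] at this

variable [ProperSpace E]

lemma integrable_smul_comp_sub [NormedSpace ℂ F] (hw : Integrable w μ) (hK : IsCompact K)
    (hsupp : μ Kᶜ = 0) {g : E → F} (hg : ContinuousOn g {0}ᶜ) {x : E} (hx : x ∉ K) :
    Integrable (fun y => w y • g (x - y)) μ := by
  obtain ⟨s, hs, -, C, hC⟩ := exists_nhds_bound_comp_sub hK hg hx
  refine (hw.norm.mul_const C).mono'
    (hw.1.smul (aestronglyMeasurable_comp_sub hK hsupp hg hx)) ?_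
  filter_upwards [ae_mem_of_measure_compl_eq_zero hsupp] with y hy
  rw [norm_smul]
  gcongr
  exact hC x (mem_of_mem_nhds hs) y hy

variable [NormedSpace ℝ E] [NormedSpace ℝ F] [NormedSpace ℂ F] [SMulCommClass ℝ ℂ F]

/-- Differentiation under the integral sign, off the support of the density. -/
lemma hasFDerivAt_convPotential (hw : Integrable w μ) (hK : IsCompact K)
    (hsupp : μ Kᶜ = 0) {g : E → F} (hg : ContDiffOn ℝ ∞ g {0}ᶜ) {x : E} (hx : x ∉ K) :
    HasFDerivAt (convPotential μ w g) (convPotential μ w (fderiv ℝ g) x) x := by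
  have hg' : ContinuousOn (fderiv ℝ g) {0}ᶜ :=
    hg.continuousOn_fderiv_of_isOpen isOpen_compl_singleton (by simp)
  obtain ⟨s, hs, hsK, C, hC⟩ := exists_nhds_bound_comp_sub hK hg' hx
  have hK' := ae_mem_of_measure_compl_eq_zero hsupp
  refine hasFDerivAt_integral_of_dominated_of_fderiv_le
    (F := fun x y => w y • g (x - y)) (F' := fun x y => w y • fderiv ℝ g (x - y))
    (bound := fun y => ‖w y‖ * C) hs ?_
    (integrable_smul_comp_sub hw hK hsupp hg.continuousOn hx)
    (integrable_smul_comp_sub hw hK hsupp hg' hx).1 ?_ (hw.norm.mul_const C) ?_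
  · filter_upwards [hs] with z hz
    exact (integrable_smul_comp_sub hw hK hsupp hg.continuousOn (hsK hz)).1
  · filter_upwards [hK'] with y hy z hz
    rw [norm_smul]
    gcongr
    exact hC z hz y hy
  · filter_upwards [hK'] with y hy z hz
    have hd : HasFDerivAt g (fderiv ℝ g (z - y)) (z - y) :=
      ((hg.differentiableOn (by simp)).differentiableAt
        (isOpen_compl_singleton.mem_nhds (sub_mem_compl_zero (hsK hz) hy))).hasFDerivAt
    exact (hd.comp z ((hasFDerivAt_id z).sub_const y)).const_smul (w y)

lemma fderiv_convPotential_apply (hw : Integrable w μ) (hK : IsCompact K)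
    (hsupp : μ Kᶜ = 0) {g : E → F} (hg : ContDiffOn ℝ ∞ g {0}ᶜ) {x : E} (hx : x ∉ K) (e : E) :
    fderiv ℝ (convPotential μ w g) x e = convPotential μ w (fun v => fderiv ℝ g v e) x := by
  rw [(hasFDerivAt_convPotential hw hK hsupp hg hx).fderiv]
  exact ContinuousLinearMap.integral_apply (integrable_smul_comp_sub hw hK hsupp
    (hg.continuousOn_fderiv_of_isOpen isOpen_compl_singleton (by simp)) hx) e

lemma contDiffOn_convPotential (hw : Integrable w μ) (hK : IsCompact K)
    (hsupp : μ Kᶜ = 0) {g : E → F} (hg : ContDiffOn ℝ ∞ g {0}ᶜ) :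
    ContDiffOn ℝ ∞ (convPotential μ w g) Kᶜ := by
  refine contDiffOn_infty.2 fun n => ?_
  have hd {G : Type} [NormedAddCommGroup G] [NormedSpace ℝ G] [NormedSpace ℂ G]
      [SMulCommClass ℝ ℂ G] {g : E → G} (hg : ContDiffOn ℝ ∞ g {0}ᶜ) :
      DifferentiableOn ℝ (convPotential μ w g) Kᶜ := fun x hx =>
    (hasFDerivAt_convPotential hw hK hsupp hg hx).differentiableAt.differentiableWithinAt
  induction n generalizing F with
  | zero => exact contDiffOn_zero.2 (hd hg).continuousOn
  | succ n ih =>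
    push_cast
    refine (contDiffOn_succ_iff_fderiv_of_isOpen hK.isClosed.isOpen_compl).2
      ⟨hd hg, by simp, ?_⟩
    refine (ih (hg.fderiv_of_isOpen isOpen_compl_singleton (by simp))).congr fun x hx => ?_
    exact (hasFDerivAt_convPotential hw hK hsupp hg hx).fderiv

end Potential

section Radial

variable {E : Type*} [NormedAddCommGroup E] [InnerProductSpace ℝ E]

lemma hasFDerivAt_norm_of_ne_zero {v : E} (hv : v ≠ 0) :
    HasFDerivAt (fun v : E => ‖v‖) (‖v‖⁻¹ • innerSL ℝ v) v := by
  have h := (hasStrictFDerivAt_norm_sq v).hasFDerivAt.sqrt (by simpa using hv)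
  simp only [Real.sqrt_sq (norm_nonneg _)] at h
  convert h using 1
  ext e
  simp
  ring

lemma fderiv_comp_norm_apply {φ : ℝ → ℂ} {φ' : ℂ} {v : E} (hv : v ≠ 0)
    (hφ : HasDerivAt φ φ' ‖v‖) (e : E) :
    fderiv ℝ (fun v => φ ‖v‖) v e = φ' / ‖v‖ * (inner ℝ v e : ℝ) := by
  have h := (hφ.hasFDerivAt.comp v (hasFDerivAt_norm_of_ne_zero hv)).fderiv
  rw [show (fun v : E => φ ‖v‖) = φ ∘ fun v => ‖v‖ from rfl, h]
  simp
  ring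

end Radial

section Helmholtz

/-- The radial profile of the Helmholtz fundamental solution. -/
noncomputable def helmholtzProfile (κ r : ℝ) : ℂ :=
  Complex.exp (Complex.I * κ * r) / (4 * Real.pi * r : ℝ)

/-- The function `φ' (r) / r`, where `φ` is the Helmholtz profile. -/
noncomputable def helmholtzProfileDerivDiv (κ r : ℝ) : ℂ :=
  Complex.exp (Complex.I * κ * r) * (Complex.I * κ * r - 1) / (4 * Real.pi * r ^ 3 : ℝ)

lemma hasDerivAt_cexp_I_mul (κ r : ℝ) :
    HasDerivAt (fun r : ℝ => Complex.exp (Complex.I * κ * r))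
      (Complex.exp (Complex.I * κ * r) * (Complex.I * κ)) r := by
  simpa using ((hasDerivAt_id r).ofReal_comp.const_mul (Complex.I * κ)).cexp

lemma hasDerivAt_helmholtzProfile (κ : ℝ) {r : ℝ} (hr : r ≠ 0) :
    HasDerivAt (helmholtzProfile κ) (helmholtzProfileDerivDiv κ r * r) r := by
  have hd : HasDerivAt (fun r : ℝ => ((4 * Real.pi * r : ℝ) : ℂ)) ((4 * Real.pi : ℝ) : ℂ) r := by
    simpa using ((hasDerivAt_id r).const_mul (4 * Real.pi)).ofReal_comp
  have hr' : (r : ℂ) ≠ 0 := by exact_mod_cast hr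
  have hπ : (Real.pi : ℂ) ≠ 0 := by exact_mod_cast Real.pi_ne_zero
  refine ((hasDerivAt_cexp_I_mul κ r).div hd (by simp [hr, Real.pi_ne_zero])).congr_deriv ?_
  simp only [helmholtzProfileDerivDiv]
  push_cast
  field_simp

lemma hasDerivAt_helmholtzProfileDerivDiv (κ : ℝ) {r : ℝ} (hr : r ≠ 0) :
    HasDerivAt (helmholtzProfileDerivDiv κ)
      (-(κ ^ 2 * helmholtzProfile κ r + 3 * helmholtzProfileDerivDiv κ r) / r) r := by
  have hd : HasDerivAt (fun r : ℝ => ((4 * Real.pi * r ^ 3 : ℝ) : ℂ))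
      ((4 * Real.pi * (3 * r ^ 2) : ℝ) : ℂ) r := by
    simpa using ((hasDerivAt_pow 3 r).const_mul (4 * Real.pi)).ofReal_comp
  have hl : HasDerivAt (fun r : ℝ => Complex.I * κ * r - 1) (Complex.I * κ) r := by
    simpa using ((hasDerivAt_id r).ofReal_comp.const_mul (Complex.I * κ)).sub_const 1
  have hr' : (r : ℂ) ≠ 0 := by exact_mod_cast hr
  have hπ : (Real.pi : ℂ) ≠ 0 := by exact_mod_cast Real.pi_ne_zero
  refine (((hasDerivAt_cexp_I_mul κ r).mul hl).div hd
    (by simp [hr, Real.pi_ne_zero])).congr_deriv ?_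
  simp only [helmholtzProfile, helmholtzProfileDerivDiv, Pi.mul_apply]
  push_cast
  field_simp
  linear_combination ((r : ℂ) ^ 2 * κ ^ 2) * Complex.I_sq

variable {E : Type*} [NormedAddCommGroup E] [InnerProductSpace ℝ E]

lemma contDiffOn_helmholtzProfile_norm (κ : ℝ) :
    ContDiffOn ℝ ∞ (fun v : E => helmholtzProfile κ ‖v‖) {0}ᶜ := by
  have hn : ContDiffOn ℝ ∞ (fun v : E => ‖v‖) {0}ᶜ :=
    contDiffOn_id.norm ℝ fun v hv => hv
  have hc {f : E → ℝ} (hf : ContDiffOn ℝ ∞ f {0}ᶜ) :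
      ContDiffOn ℝ ∞ (fun v => (f v : ℂ)) {0}ᶜ :=
    Complex.ofRealCLM.contDiff.comp_contDiffOn hf
  simp only [helmholtzProfile, div_eq_mul_inv]
  refine (contDiffOn_const.mul (hc hn)).cexp.mul
    ((hc (contDiffOn_const.mul hn)).inv fun v hv => ?_)
  simpa [Real.pi_ne_zero] using hv

lemma fderiv_helmholtzProfile_norm_apply (κ : ℝ) {v : E} (hv : v ≠ 0) (e : E) :
    fderiv ℝ (fun v : E => helmholtzProfile κ ‖v‖) v e =
      helmholtzProfileDerivDiv κ ‖v‖ * (inner ℝ v e : ℝ) := by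
  have hv' : (‖v‖ : ℂ) ≠ 0 := by simpa using hv
  rw [fderiv_comp_norm_apply hv (hasDerivAt_helmholtzProfile κ (norm_ne_zero_iff.2 hv)),
    mul_div_cancel_right₀ _ hv']

lemma fderiv_fderiv_helmholtzProfile_norm_apply (κ : ℝ) {v : E} (hv : v ≠ 0) (e : E) :
    fderiv ℝ (fun z => fderiv ℝ (fun v : E => helmholtzProfile κ ‖v‖) z e) v e =
      helmholtzProfileDerivDiv κ ‖v‖ * (‖e‖ ^ 2 : ℝ) -
        (κ ^ 2 * helmholtzProfile κ ‖v‖ + 3 * helmholtzProfileDerivDiv κ ‖v‖) / ‖v‖ ^ 2 *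
          (inner ℝ v e ^ 2 : ℝ) := by
  have hφ := hasDerivAt_helmholtzProfileDerivDiv κ (norm_ne_zero_iff.2 hv)
  have heq : (fun z => fderiv ℝ (fun v : E => helmholtzProfile κ ‖v‖) z e) =ᶠ[𝓝 v]
      fun z => helmholtzProfileDerivDiv κ ‖z‖ * (inner ℝ z e : ℝ) := by
    filter_upwards [isOpen_compl_singleton.mem_nhds (show v ∈ ({0}ᶜ : Set E) from hv)] with z hz
    exact fderiv_helmholtzProfile_norm_apply κ hz e
  have h1 : DifferentiableAt ℝ (fun z : E => helmholtzProfileDerivDiv κ ‖z‖) v :=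
    hφ.differentiableAt.comp v (hasFDerivAt_norm_of_ne_zero hv).differentiableAt
  have h2 : HasFDerivAt (fun z : E => ((inner ℝ z e : ℝ) : ℂ))
      (Complex.ofRealCLM ∘L innerSL ℝ e) v := by
    simp_rw [real_inner_comm e]
    exact (Complex.ofRealCLM ∘L innerSL ℝ e).hasFDerivAt
  rw [heq.fderiv_eq, fderiv_fun_mul h1 h2.differentiableAt, h2.fderiv]
  simp only [_root_.add_apply, _root_.smul_apply,
    fderiv_comp_norm_apply hv hφ]
  have hv' : (‖v‖ : ℂ) ≠ 0 := by simpa using hv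
  simp
  field_simp
  ring

lemma laplacianC_helmholtzProfile_norm (κ : ℝ) {v : EuclideanSpace ℝ (Fin 3)} (hv : v ≠ 0) :
    laplacianC (fun v => helmholtzProfile κ ‖v‖) v = -κ ^ 2 * helmholtzProfile κ ‖v‖ := by
  have hv' : (‖v‖ : ℂ) ≠ 0 := by simpa using hv
  have hs : (‖v‖ : ℂ) ^ 2 = ∑ k, (v k : ℂ) ^ 2 := by
    exact_mod_cast EuclideanSpace.real_norm_sq_eq v
  simp only [laplacianC, fderiv_fderiv_helmholtzProfile_norm_apply κ hv, Finset.sum_sub_distrib,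
    ← Finset.mul_sum]
  simp [EuclideanSpace.inner_single_right, ← hs]
  field_simp
  ring

end Helmholtz

lemma laplacianC_convPotential {μ : Measure (EuclideanSpace ℝ (Fin 3))}
    {w : EuclideanSpace ℝ (Fin 3) → ℂ} {K : Set (EuclideanSpace ℝ (Fin 3))}
    (hw : Integrable w μ) (hK : IsCompact K) (hsupp : μ Kᶜ = 0)
    {g : EuclideanSpace ℝ (Fin 3) → ℂ} (hg : ContDiffOn ℝ ∞ g {0}ᶜ)
    {x : EuclideanSpace ℝ (Fin 3)} (hx : x ∉ K) :
    laplacianC (convPotential μ w g) x = convPotential μ w (laplacianC g) x := by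
  have hdir {f : EuclideanSpace ℝ (Fin 3) → ℂ} (hf : ContDiffOn ℝ ∞ f {0}ᶜ)
      (e : EuclideanSpace ℝ (Fin 3)) : ContDiffOn ℝ ∞ (fun z => fderiv ℝ f z e) {0}ᶜ :=
    (hf.fderiv_of_isOpen isOpen_compl_singleton (by simp)).clm_apply contDiffOn_const
  simp only [laplacianC, convPotential, Finset.smul_sum]
  rw [integral_finsetSum _ fun k _ => integrable_smul_comp_sub hw hK hsupp
    (hdir (hdir hg _) _).continuousOn hx]
  refine Finset.sum_congr rfl fun k _ => ?_
  have heq : (fun z => fderiv ℝ (convPotential μ w g) z (EuclideanSpace.single k 1)) =ᶠ[𝓝 x]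
      convPotential μ w fun z => fderiv ℝ g z (EuclideanSpace.single k 1) := by
    filter_upwards [hK.isClosed.isOpen_compl.mem_nhds (show x ∈ Kᶜ from hx)] with z hz
    exact fderiv_convPotential_apply hw hK hsupp hg hz _
  rw [heq.fderiv_eq]
  exact fderiv_convPotential_apply hw hK hsupp (hdir hg _) hx _

/-- Single layer potential for the Helmholtz kernel: a finite complex Borel
measure is represented (via its polar/Radon–Nikodym decomposition) as `w dμ`
with `μ` a finite positive Borel measure and `w : ℝ³ → ℂ` integrable. If the
measure is supported in a compact set `K` (i.e. `μ(Kᶜ) = 0`), then the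
Helmholtz single layer potential `u(x) = ∫ exp(iκ‖x - y‖)/(4π‖x - y‖) dμ(y)` is
well defined (the integrand is integrable for each `x ∉ K`), infinitely
differentiable on `ℝ³ \ K`, and satisfies the Helmholtz equation there:
`Δu(x) + κ²u(x) = 0` for every `x ∉ K`. -/
theorem helmholtz_single_layer_potential_smooth_and_helmholtz
    (κ : ℝ)
    (μ : Measure (EuclideanSpace ℝ (Fin 3))) [IsFiniteMeasure μ]
    (w : EuclideanSpace ℝ (Fin 3) → ℂ) (hw : Integrable w μ)
    (K : Set (EuclideanSpace ℝ (Fin 3))) (hK : IsCompact K)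
    (hsupp : μ Kᶜ = 0) :
    (∀ x ∉ K, Integrable (fun y => w y * helmholtzKernel κ x y) μ) ∧
    ContDiffOn ℝ (⊤ : ℕ∞)
      (fun x => ∫ y, w y * helmholtzKernel κ x y ∂μ) Kᶜ ∧
    (∀ x ∉ K,
        laplacianC (fun x => ∫ y, w y * helmholtzKernel κ x y ∂μ) x
            + (κ : ℂ) ^ 2 * ∫ y, w y * helmholtzKernel κ x y ∂μ = 0) := by
  have hg := contDiffOn_helmholtzProfile_norm (E := EuclideanSpace ℝ (Fin 3)) κ
  refine ⟨fun x hx => integrable_smul_comp_sub hw hK hsupp hg.continuousOn hx,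
    contDiffOn_convPotential hw hK hsupp hg, fun x hx => ?_⟩
  have h := laplacianC_convPotential hw hK hsupp hg hx
  have hae : convPotential μ w (laplacianC fun v => helmholtzProfile κ ‖v‖) x =
      -κ ^ 2 * ∫ y, w y * helmholtzKernel κ x y ∂μ := by
    rw [← integral_const_mul]
    refine integral_congr_ae ?_
    filter_upwards [ae_mem_of_measure_compl_eq_zero hsupp] with y hy
    rw [laplacianC_helmholtzProfile_norm κ (sub_mem_compl_zero hx hy), smul_eq_mul,
      mul_left_comm]
    rfl
  rw [hae] at h
  exact (congrArg (· + _) h).trans (by ring)
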